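/- arXiv:2101.02172 — 3 statements merged into one kernel-verified Lean document; each statement's English description precedes it below -/
import Mathlib

section
/- Let U ⊆ ℂ² be a nonempty open set and let γ₁, γ₂, δ₁, δ₂, η₁, η₂ : U → ℂ be holomorphic. Set P(x,y,z) = γ₁(x,y) + δ₁(x,y)z + η₁(x,y)z² and Q(x,y,z) = γ₂(x,y) + δ₂(x,y)z + η₂(x,y)z². Then the Frobenius integrability expression E := ∂ₓQ − ∂_yP − P·∂_zQ + Q·∂_zP vanishes identically on U × ℂ if and only if the three structure equations hold on U: ∂ₓγ₂ − ∂_yγ₁ = γ₁δ₂ − γ₂δ₁, ∂ₓδ₂ − ∂_yδ₁ = 2(γ₁η₂ − γ₂η₁), and ∂ₓη₂ − ∂_yη₁ = δ₁η₂ − δ₂η₁. -/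
/-- Partial derivative in the first coordinate of `ℂ × ℂ`. -/
noncomputable def pdx (f : ℂ × ℂ → ℂ) (p : ℂ × ℂ) : ℂ := fderiv ℂ f p (1, 0)

/-- Partial derivative in the second coordinate of `ℂ × ℂ`. -/
noncomputable def pdy (f : ℂ × ℂ → ℂ) (p : ℂ × ℂ) : ℂ := fderiv ℂ f p (0, 1)

/-- Frobenius integrability of the Riccati distribution
`ω = dz + γ + δz + ηz²` is equivalent to the three structure equations. -/
theorem riccati_integrability_iff_structure_equations
    (U : Set (ℂ × ℂ)) (hU : IsOpen U) (hne : U.Nonempty)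
    (γ₁ γ₂ δ₁ δ₂ η₁ η₂ : ℂ × ℂ → ℂ)
    (hγ₁ : DifferentiableOn ℂ γ₁ U) (hγ₂ : DifferentiableOn ℂ γ₂ U)
    (hδ₁ : DifferentiableOn ℂ δ₁ U) (hδ₂ : DifferentiableOn ℂ δ₂ U)
    (hη₁ : DifferentiableOn ℂ η₁ U) (hη₂ : DifferentiableOn ℂ η₂ U)
    (P Q : ℂ × ℂ → ℂ → ℂ)
    (hP : ∀ p z, P p z = γ₁ p + δ₁ p * z + η₁ p * z ^ 2)
    (hQ : ∀ p z, Q p z = γ₂ p + δ₂ p * z + η₂ p * z ^ 2) :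
    (∀ p ∈ U, ∀ z : ℂ,
        pdx (fun q => Q q z) p - pdy (fun q => P q z) p
          - P p z * deriv (Q p) z + Q p z * deriv (P p) z = 0)
      ↔ (∀ p ∈ U,
          pdx γ₂ p - pdy γ₁ p = γ₁ p * δ₂ p - γ₂ p * δ₁ p ∧
          pdx δ₂ p - pdy δ₁ p = 2 * (γ₁ p * η₂ p - γ₂ p * η₁ p) ∧
          pdx η₂ p - pdy η₁ p = δ₁ p * η₂ p - δ₂ p * η₁ p) := by
  have key : ∀ (a b c : ℂ × ℂ → ℂ) (p v : ℂ × ℂ) (z : ℂ), DifferentiableAt ℂ a p →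
      DifferentiableAt ℂ b p → DifferentiableAt ℂ c p →
      fderiv ℂ (fun q => a q + b q * z + c q * z ^ 2) p v
        = fderiv ℂ a p v + fderiv ℂ b p v * z + fderiv ℂ c p v * z ^ 2 := by
    intro a b c p v z ha hb hc
    have h := ((ha.hasFDerivAt.add (hb.hasFDerivAt.mul_const z)).add
      (hc.hasFDerivAt.mul_const (z ^ 2))).fderiv
    have h' := congrArg (fun L => L v) h
    refine Eq.trans h' ?_
    simp
    ring
  have dz : ∀ (a b c z : ℂ), deriv (fun w : ℂ => a + b * w + c * w ^ 2) z
      = b + 2 * c * z := by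
    intro a b c z
    have h := ((((hasDerivAt_id z).const_mul b).const_add a).add
      ((hasDerivAt_pow 2 z).const_mul c)).deriv
    refine Eq.trans h ?_
    simp
    ring
  have hE : ∀ p ∈ U, ∀ z : ℂ,
      pdx (fun q => Q q z) p - pdy (fun q => P q z) p
          - P p z * deriv (Q p) z + Q p z * deriv (P p) z
      = (pdx γ₂ p - pdy γ₁ p - (γ₁ p * δ₂ p - γ₂ p * δ₁ p))
        + (pdx δ₂ p - pdy δ₁ p - 2 * (γ₁ p * η₂ p - γ₂ p * η₁ p)) * z
        + (pdx η₂ p - pdy η₁ p - (δ₁ p * η₂ p - δ₂ p * η₁ p)) * z ^ 2 := by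
    intro p hp z
    have hn := hU.mem_nhds hp
    have eP : P = fun p z => γ₁ p + δ₁ p * z + η₁ p * z ^ 2 := by
      funext p z; exact hP p z
    have eQ : Q = fun p z => γ₂ p + δ₂ p * z + η₂ p * z ^ 2 := by
      funext p z; exact hQ p z
    subst eP eQ
    simp only [pdx, pdy]
    rw [key _ _ _ _ _ _ (hγ₁.differentiableAt hn) (hδ₁.differentiableAt hn)
        (hη₁.differentiableAt hn),
      key _ _ _ _ _ _ (hγ₂.differentiableAt hn) (hδ₂.differentiableAt hn)
        (hη₂.differentiableAt hn), dz, dz]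
    ring
  constructor
  · intro h p hp
    have h0 := (hE p hp 0).symm.trans (h p hp 0)
    have h1 := (hE p hp 1).symm.trans (h p hp 1)
    have h2 := (hE p hp (-1)).symm.trans (h p hp (-1))
    refine ⟨?_, ?_, ?_⟩
    · linear_combination h0
    · linear_combination (h1 - h2) / 2
    · linear_combination (h1 + h2) / 2 - h0
  · intro h p hp z
    obtain ⟨h0, h1, h2⟩ := h p hp
    rw [hE p hp z]
    linear_combination h0 + z * h1 + z ^ 2 * h2
end

section
/- Let A₁, A₂ be 2×2 complex matrices with A₁A₂ = A₂A₁ and tr(A₁) = tr(A₂) = 0. Then there exists an invertible 2×2 complex matrix C such that one of the following holds: (Type 1) there exist a, b ∈ ℂ with C⁻¹A₁C = [[−a/2, 0],[0, a/2]] and C⁻¹A₂C = [[−b/2, 0],[0, b/2]]; (Type 2) there exists c ∈ ℂ with C⁻¹A₁C = [[0,1],[0,0]] and C⁻¹A₂C = [[0,c],[0,0]]; (Type 3) C⁻¹A₁C = 0 and C⁻¹A₂C = [[0,1],[0,0]]. -/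
/-- Normal form of a single traceless matrix. -/
lemma traceless_normal_form (p q r : ℂ) :
    ∃ C : Matrix (Fin 2) (Fin 2) ℂ, C.det ≠ 0 ∧
      ((∃ a : ℂ, !![p, q; r, -p] * C = C * !![-(a / 2), 0; 0, a / 2]) ∨
        !![p, q; r, -p] * C = C * !![0, 1; 0, 0]) := by
  obtain ⟨d, hd⟩ : ∃ d : ℂ, p ^ 2 + q * r = d ^ 2 := by
    obtain ⟨d, hd⟩ := IsAlgClosed.exists_pow_nat_eq (p ^ 2 + q * r) (n := 2) (by norm_num)
    exact ⟨d, hd.symm⟩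
  by_cases hq : q = 0
  · subst hq
    by_cases hp : p = 0
    · subst hp
      by_cases hr : r = 0
      · subst hr
        refine ⟨1, by simp, Or.inl ⟨0, ?_⟩⟩
        ext i j
        fin_cases i <;> fin_cases j <;> simp
      · refine ⟨!![0, 1; r, 0], by simp [Matrix.det_fin_two, hr], Or.inr ?_⟩
        ext i j
        fin_cases i <;> fin_cases j <;> simp [Matrix.mul_apply, Fin.sum_univ_two]
    · refine ⟨!![0, 2 * p; 1, r], by simp [Matrix.det_fin_two, hp], Or.inl ⟨2 * p, ?_⟩⟩
      ext i j
      fin_cases i <;> fin_cases j <;> simp [Matrix.mul_apply, Fin.sum_univ_two] <;> ring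
  · by_cases h0 : d = 0
    · subst h0
      refine ⟨!![q, 0; -p, 1], by simp [Matrix.det_fin_two, hq], Or.inr ?_⟩
      ext i j
      fin_cases i <;> fin_cases j <;> simp [Matrix.mul_apply, Fin.sum_univ_two] <;>
        first | ring1 | linear_combination hd
    · refine ⟨!![q, q; -d - p, d - p], ?_, Or.inl ⟨2 * d, ?_⟩⟩
      · have : Matrix.det !![q, q; -d - p, d - p] = 2 * q * d := by
          rw [Matrix.det_fin_two_of]; ring
        rw [this]
        exact mul_ne_zero (mul_ne_zero two_ne_zero hq) h0
      · ext i j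
        fin_cases i <;> fin_cases j <;> simp [Matrix.mul_apply, Fin.sum_univ_two] <;>
          first | ring1 | linear_combination hd

lemma exists_normal_form (A : Matrix (Fin 2) (Fin 2) ℂ) (h : A.trace = 0) :
    ∃ C : Matrix (Fin 2) (Fin 2) ℂ, IsUnit C ∧
      ((∃ a : ℂ, C⁻¹ * A * C = !![-(a / 2), 0; 0, a / 2]) ∨
        C⁻¹ * A * C = !![0, 1; 0, 0]) := by
  have h1 : A 1 1 = -A 0 0 := by
    rw [Matrix.trace_fin_two] at h
    linear_combination h
  have hA : A = !![A 0 0, A 0 1; A 1 0, -A 0 0] := by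
    rw [← h1]; exact Matrix.eta_fin_two A
  obtain ⟨C, hC, hh⟩ := traceless_normal_form (A 0 0) (A 0 1) (A 1 0)
  rw [← hA] at hh
  have hu : IsUnit C.det := isUnit_iff_ne_zero.mpr hC
  refine ⟨C, (Matrix.isUnit_iff_isUnit_det C).mpr hu, ?_⟩
  rcases hh with ⟨a, ha⟩ | ha
  · exact Or.inl ⟨a, by rw [mul_assoc, ha, Matrix.nonsing_inv_mul_cancel_left _ _ hu]⟩
  · exact Or.inr (by rw [mul_assoc, ha, Matrix.nonsing_inv_mul_cancel_left _ _ hu])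

lemma zero_or_smul (A B : Matrix (Fin 2) (Fin 2) ℂ) (hcomm : A * B = B * A)
    (hA : A.trace = 0) (hB : B.trace = 0) : A = 0 ∨ ∃ c : ℂ, B = c • A := by
  have a1 : A 1 1 = -A 0 0 := by
    rw [Matrix.trace_fin_two] at hA
    linear_combination hA
  have b1 : B 1 1 = -B 0 0 := by
    rw [Matrix.trace_fin_two] at hB
    linear_combination hB
  have e0 := congrFun (congrFun hcomm 0) 0
  have e1 := congrFun (congrFun hcomm 0) 1
  have e2 := congrFun (congrFun hcomm 1) 0
  simp only [Matrix.mul_apply, Fin.sum_univ_two, a1, b1] at e0 e1 e2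
  by_cases h0 : A 0 0 = 0
  · by_cases h1 : A 0 1 = 0
    · by_cases h2 : A 1 0 = 0
      · left
        ext i j
        fin_cases i <;> fin_cases j <;> simp [*]
      · right
        refine ⟨B 1 0 / A 1 0, ?_⟩
        ext i j
        fin_cases i <;> fin_cases j <;> simp [a1, b1] <;> field_simp <;> grind
    · right
      refine ⟨B 0 1 / A 0 1, ?_⟩
      ext i j
      fin_cases i <;> fin_cases j <;> simp [a1, b1] <;> field_simp <;> grind
  · right
    refine ⟨B 0 0 / A 0 0, ?_⟩
    ext i j
    fin_cases i <;> fin_cases j <;> simp [a1, b1] <;> field_simp <;> grind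

/-- Classification of pairs of commuting traceless `2 × 2` complex matrices up to
simultaneous conjugation: every such pair is conjugate to one of the three
normal forms (Type 1: both diagonal; Type 2: both strictly upper triangular
nilpotent; Type 3: the first is zero and the second is nilpotent). -/
theorem commuting_traceless_pair_classification
    (A₁ A₂ : Matrix (Fin 2) (Fin 2) ℂ)
    (hcomm : A₁ * A₂ = A₂ * A₁)
    (htr₁ : A₁.trace = 0) (htr₂ : A₂.trace = 0) :
    ∃ C : Matrix (Fin 2) (Fin 2) ℂ, IsUnit C ∧
      ((∃ a b : ℂ,
          C⁻¹ * A₁ * C = !![-(a / 2), 0; 0, a / 2] ∧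
          C⁻¹ * A₂ * C = !![-(b / 2), 0; 0, b / 2]) ∨
       (∃ c : ℂ,
          C⁻¹ * A₁ * C = !![0, 1; 0, 0] ∧
          C⁻¹ * A₂ * C = !![0, c; 0, 0]) ∨
       (C⁻¹ * A₁ * C = 0 ∧
          C⁻¹ * A₂ * C = !![0, 1; 0, 0])) := by
  rcases zero_or_smul A₁ A₂ hcomm htr₁ htr₂ with h | ⟨c, h⟩
  · subst h
    obtain ⟨C, hC, ⟨a, ha⟩ | ha⟩ := exists_normal_form A₂ htr₂
    · refine ⟨C, hC, Or.inl ⟨0, a, ?_, ha⟩⟩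
      ext i j
      fin_cases i <;> fin_cases j <;> simp
    · exact ⟨C, hC, Or.inr (Or.inr ⟨by simp, ha⟩)⟩
  · obtain ⟨C, hC, ⟨a, ha⟩ | ha⟩ := exists_normal_form A₁ htr₁
    · refine ⟨C, hC, Or.inl ⟨a, c * a, ha, ?_⟩⟩
      rw [h, Matrix.mul_smul, Matrix.smul_mul, ha]
      ext i j
      fin_cases i <;> fin_cases j <;> simp <;> ring
    · refine ⟨C, hC, Or.inr (Or.inl ⟨c, ha, ?_⟩)⟩
      rw [h, Matrix.mul_smul, Matrix.smul_mul, ha]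
      ext i j
      fin_cases i <;> fin_cases j <;> simp
end

section
/- Let U ⊆ ℂ² be a nonempty open set and let A₁, A₂ : U → M₂(ℂ) be holomorphic matrix-valued functions satisfying the torsion-free conditions (A₁)₁₂ = (A₂)₁₁ and (A₁)₂₂ = (A₂)₂₁. Define γᵢ = (Aᵢ)₂₁, δᵢ = (Aᵢ)₂₂ − (Aᵢ)₁₁, ηᵢ = −(Aᵢ)₁₂ for i = 1,2, and the connection form components κ₁ = δ₁/2 − γ₂ and κ₂ = η₁ − δ₂/2. Then κ₁ = −(1/2)tr(A₁) and κ₂ = −(1/2)tr(A₂) on U; consequently ∂ₓκ₂ − ∂_yκ₁ = −(1/2)(∂ₓ tr(A₂) − ∂_y tr(A₁)). -/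
/-- For a torsion-free affine connection `θ = A₁ dx + A₂ dy`, the connection
form `κ = κ₁ dx + κ₂ dy` of the induced Riccati distribution satisfies
`κᵢ = −(1/2) tr Aᵢ`, hence `∂ₓκ₂ − ∂_yκ₁ = −(1/2)(∂ₓ tr A₂ − ∂_y tr A₁)`,
i.e. `K_{Tr ∇} = −2 K(H^∇)`. -/
theorem connection_form_is_half_trace
    (U : Set (ℂ × ℂ)) (hU : IsOpen U) (hne : U.Nonempty)
    (A₁ A₂ : ℂ × ℂ → Matrix (Fin 2) (Fin 2) ℂ)
    (hdiff₁ : ∀ i j, DifferentiableOn ℂ (fun q => A₁ q i j) U)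
    (hdiff₂ : ∀ i j, DifferentiableOn ℂ (fun q => A₂ q i j) U)
    (htf₁ : ∀ p ∈ U, A₁ p 0 1 = A₂ p 0 0)
    (htf₂ : ∀ p ∈ U, A₁ p 1 1 = A₂ p 1 0)
    (γ₁ γ₂ δ₁ δ₂ η₁ η₂ κ₁ κ₂ : ℂ × ℂ → ℂ)
    (hγ₁ : ∀ p, γ₁ p = A₁ p 1 0) (hγ₂ : ∀ p, γ₂ p = A₂ p 1 0)
    (hδ₁ : ∀ p, δ₁ p = A₁ p 1 1 - A₁ p 0 0) (hδ₂ : ∀ p, δ₂ p = A₂ p 1 1 - A₂ p 0 0)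
    (hη₁ : ∀ p, η₁ p = -(A₁ p 0 1)) (hη₂ : ∀ p, η₂ p = -(A₂ p 0 1))
    (hκ₁ : ∀ p, κ₁ p = δ₁ p / 2 - γ₂ p)
    (hκ₂ : ∀ p, κ₂ p = η₁ p - δ₂ p / 2) :
    (∀ p ∈ U, κ₁ p = -(1 / 2) * (A₁ p).trace ∧ κ₂ p = -(1 / 2) * (A₂ p).trace) ∧
      ∀ p ∈ U,
        pdx κ₂ p - pdy κ₁ p
          = -(1 / 2) * (pdx (fun q => (A₂ q).trace) p - pdy (fun q => (A₁ q).trace) p) := by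
  have key : ∀ p ∈ U, κ₁ p = -(1 / 2) * (A₁ p).trace ∧ κ₂ p = -(1 / 2) * (A₂ p).trace := by
    intro p hp
    have h1 := htf₁ p hp
    have h2 := htf₂ p hp
    rw [hκ₁, hκ₂, hδ₁, hδ₂, hγ₂, hη₁, Matrix.trace_fin_two, Matrix.trace_fin_two, h1, ← h2]
    constructor <;> ring
  refine ⟨key, fun p hp => ?_⟩
  have hn : U ∈ nhds p := hU.mem_nhds hp
  have e1 : κ₁ =ᶠ[nhds p] fun q => -(1 / 2) * (A₁ q).trace :=
    Filter.mem_of_superset hn fun q hq => (key q hq).1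
  have e2 : κ₂ =ᶠ[nhds p] fun q => -(1 / 2) * (A₂ q).trace :=
    Filter.mem_of_superset hn fun q hq => (key q hq).2
  have d1 : DifferentiableAt ℂ (fun q => (A₁ q).trace) p := by
    simp only [Matrix.trace_fin_two]
    exact ((hdiff₁ 0 0).differentiableAt hn).add ((hdiff₁ 1 1).differentiableAt hn)
  have d2 : DifferentiableAt ℂ (fun q => (A₂ q).trace) p := by
    simp only [Matrix.trace_fin_two]
    exact ((hdiff₂ 0 0).differentiableAt hn).add ((hdiff₂ 1 1).differentiableAt hn)
  unfold pdx pdy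
  rw [e1.fderiv_eq, e2.fderiv_eq, fderiv_const_mul d1, fderiv_const_mul d2]
  simp only [ContinuousLinearMap.smul_apply, smul_eq_mul]
  ring
end
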